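/- arXiv:math/0309179 — 2 statements merged into one kernel-verified Lean document; each statement's English description precedes it below -/
import Mathlib

section
/- Let M and N be Hausdorff topological manifolds (locally Euclidean Hausdorff spaces, not assumed second-countable, paracompact or connected). Then for every isomorphism of ℝ-algebras T : C(N, ℝ) → C(M, ℝ) between the algebras of continuous real-valued functions, there exists a unique homeomorphism τ : M → N such that T(g) = g ∘ τ for every g ∈ C(N, ℝ). -/
/-- A charted space modelled on a first-countable space is first-countable. -/
theorem ChartedSpace.firstCountableTopology (H M : Type*) [TopologicalSpace H]
    [TopologicalSpace M] [ChartedSpace H M] [FirstCountableTopology H] :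
    FirstCountableTopology M where
  nhds_generated_countable x := by
    rw [← (chartAt H x).symm_map_nhds_eq (mem_chart_source H x)]
    infer_instance

section LocallyCompact

variable {X Y : Type*} [TopologicalSpace X] [T2Space X] [LocallyCompactSpace X]
  [FirstCountableTopology X] [TopologicalSpace Y]

/-- In a first-countable locally compact Hausdorff space, each point is the zero set of a
continuous function which is `1` on a prescribed closed set avoiding the point. -/
theorem exists_continuousMap_eq_zero_iff_eq_of_notMem_isClosed {x : X} {t : Set X}
    (ht : IsClosed t) (hx : x ∉ t) :
    ∃ f : C(X, ℝ), (∀ z, f z = 0 ↔ z = x) ∧ ∀ z ∈ t, f z = 1 := by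
  obtain ⟨f, hfx, hft, -⟩ := exists_continuous_one_zero_of_isCompact_of_isGδ
    (isCompact_singleton (x := x)) (IsGδ.singleton x) ht (Set.disjoint_singleton_left.2 hx)
  refine ⟨1 - f, fun z ↦ ?_, fun z hz ↦ by simp [hft hz]⟩
  have hz : z ∈ ({x} : Set X) ↔ z ∈ f ⁻¹' {1} := by rw [← hfx]
  rw [ContinuousMap.sub_apply, ContinuousMap.one_apply, sub_eq_zero, eq_comm]
  exact hz.symm

theorem eq_of_forall_continuousMap_apply_eq {x y : X} (h : ∀ f : C(X, ℝ), f x = f y) :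
    x = y := by
  obtain ⟨f, hf, -⟩ := exists_continuousMap_eq_zero_iff_eq_of_notMem_isClosed
    isClosed_empty (Set.notMem_empty y)
  exact (hf x).1 ((h f).trans ((hf y).2 rfl))

theorem continuous_of_forall_continuousMap_comp {τ : Y → X}
    (h : ∀ f : C(X, ℝ), Continuous (f ∘ τ)) : Continuous τ := by
  refine continuous_iff_continuousAt.2 fun y ↦ tendsto_nhds.2 fun U hU hy ↦ ?_
  obtain ⟨f, hf, hfU⟩ := exists_continuousMap_eq_zero_iff_eq_of_notMem_isClosed
    hU.isClosed_compl (Set.notMem_compl_iff.2 hy)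
  have hlt : (f ∘ τ) y < 1 := by simp [(hf (τ y)).2 rfl]
  filter_upwards [(h f).continuousAt.eventually_lt continuousAt_const hlt] with z hz
  by_contra hzU
  exact hz.ne (hfU _ hzU)

/-- Evaluation at a point of `X`, transported by an algebra isomorphism, is evaluation at a
point of `Y`. -/
theorem AlgEquiv.exists_forall_continuousMap_apply_eq (T : C(Y, ℝ) ≃ₐ[ℝ] C(X, ℝ)) (x : X) :
    ∃ y : Y, ∀ g : C(Y, ℝ), T g x = g y := by
  obtain ⟨f, hf, -⟩ := exists_continuousMap_eq_zero_iff_eq_of_notMem_isClosed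
    isClosed_empty (Set.notMem_empty x)
  have hunit : ¬ IsUnit (T.symm f) := fun hu ↦ by
    have := hu.map T
    rw [T.apply_symm_apply, ContinuousMap.isUnit_iff_forall_ne_zero] at this
    exact this x ((hf x).2 rfl)
  rw [ContinuousMap.isUnit_iff_forall_ne_zero] at hunit
  push Not at hunit
  obtain ⟨y, hy⟩ := hunit
  refine ⟨y, fun g ↦ ?_⟩
  set k : C(Y, ℝ) := T.symm f ^ 2 + (g - algebraMap ℝ C(Y, ℝ) (g y)) ^ 2 with hk
  have hky : k y = 0 := by simp [hk, hy]
  have hTk : ¬ IsUnit (T k) := fun hu ↦ by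
    have := hu.map T.symm
    rw [T.symm_apply_apply, ContinuousMap.isUnit_iff_forall_ne_zero] at this
    exact this y hky
  rw [ContinuousMap.isUnit_iff_forall_ne_zero] at hTk
  push Not at hTk
  obtain ⟨z, hz⟩ := hTk
  have hz' : f z ^ 2 + (T g z - g y) ^ 2 = 0 := by
    simpa [hk, AlgEquiv.commutes] using hz
  have hfz : f z = 0 := by nlinarith [sq_nonneg (f z), sq_nonneg (T g z - g y)]
  obtain rfl := (hf z).1 hfz
  simpa [hfz, sub_eq_zero] using hz'

end LocallyCompact

/-- An isomorphism between algebras of continuous functions on first-countable locally compact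
Hausdorff spaces is composition with a unique homeomorphism. -/
theorem AlgEquiv.existsUnique_homeomorph_continuousMap {X Y : Type*}
    [TopologicalSpace X] [T2Space X] [LocallyCompactSpace X] [FirstCountableTopology X]
    [TopologicalSpace Y] [T2Space Y] [LocallyCompactSpace Y] [FirstCountableTopology Y]
    (T : C(Y, ℝ) ≃ₐ[ℝ] C(X, ℝ)) :
    ∃! τ : X ≃ₜ Y, ∀ g : C(Y, ℝ), ⇑(T g) = ⇑g ∘ ⇑τ := by
  choose τ hτ using T.exists_forall_continuousMap_apply_eq
  choose σ hσ using T.symm.exists_forall_continuousMap_apply_eq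
  refine ⟨⟨⟨τ, σ, fun x ↦ ?_, fun y ↦ ?_⟩, ?_, ?_⟩, fun g ↦ funext fun x ↦ hτ x g, ?_⟩
  · exact eq_of_forall_continuousMap_apply_eq fun f ↦ by
      rw [← hσ, ← hτ, T.apply_symm_apply]
  · exact eq_of_forall_continuousMap_apply_eq fun f ↦ by
      rw [← hτ, ← hσ, T.symm_apply_apply]
  · exact continuous_of_forall_continuousMap_comp fun f ↦
      (T f).continuous.congr fun x ↦ hτ x f
  · exact continuous_of_forall_continuousMap_comp fun f ↦
      (T.symm f).continuous.congr fun y ↦ hσ y f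
  · intro τ' hτ'
    ext x
    exact eq_of_forall_continuousMap_apply_eq fun f ↦
      (congrFun (hτ' f) x).symm.trans (hτ x f)

/-- **Continuous version of Mrčun's theorem.** For Hausdorff topological manifolds `M` and
`N` (locally Euclidean Hausdorff spaces, not assumed second-countable, paracompact or
connected), any isomorphism of ℝ-algebras `T : C(N, ℝ) → C(M, ℝ)` between the algebras of
continuous real-valued functions is given by composition with a unique homeomorphism
`τ : M → N`. -/
theorem continuous_function_algebra_iso_is_comp_homeomorph
    {dM dN : ℕ}
    {M : Type*} [TopologicalSpace M] [T2Space M]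
    [ChartedSpace (EuclideanSpace ℝ (Fin dM)) M]
    {N : Type*} [TopologicalSpace N] [T2Space N]
    [ChartedSpace (EuclideanSpace ℝ (Fin dN)) N]
    (T : C(N, ℝ) ≃ₐ[ℝ] C(M, ℝ)) :
    ∃! τ : M ≃ₜ N, ∀ g : C(N, ℝ), ⇑(T g) = ⇑g ∘ ⇑τ := by
  have := ChartedSpace.locallyCompactSpace (EuclideanSpace ℝ (Fin dM)) M
  have := ChartedSpace.locallyCompactSpace (EuclideanSpace ℝ (Fin dN)) N
  have := ChartedSpace.firstCountableTopology (EuclideanSpace ℝ (Fin dM)) M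
  have := ChartedSpace.firstCountableTopology (EuclideanSpace ℝ (Fin dN)) N
  exact T.existsUnique_homeomorph_continuousMap
end

section
/- Let M and N be Hausdorff topological manifolds (locally Euclidean Hausdorff spaces, not assumed second-countable, paracompact or connected). Let C_c(N, ℝ) and C_c(M, ℝ) denote the (non-unital) algebras of continuous real-valued functions with compact support. Then for every isomorphism of non-unital ℝ-algebras T : C_c(N, ℝ) → C_c(M, ℝ) (a bijective ℝ-linear multiplicative map), there exists a unique homeomorphism τ : M → N such that T(g) = g ∘ τ for every g ∈ C_c(N, ℝ). -/
open scoped CompactlySupported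

namespace CompactlySupportedContinuousMap

open Set Topology

variable {X : Type*} [TopologicalSpace X]

/-- In a locally compact Hausdorff space, points can be separated from complements of open
neighbourhoods by compactly supported continuous functions. -/
theorem exists_apply_eq_one_of_mem_isOpen [LocallyCompactSpace X] [T2Space X] {U : Set X}
    (hU : IsOpen U) {x : X} (hx : x ∈ U) :
    ∃ f : C_c(X, ℝ), f x = 1 ∧ ∀ y ∉ U, f y = 0 := by
  obtain ⟨f, hf1, hf0, hfc, -⟩ := exists_continuous_one_zero_of_isCompact
    (isCompact_singleton (x := x)) hU.isClosed_compl
    (disjoint_singleton_left.2 fun h => h hx)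
  exact ⟨⟨f, hfc⟩, hf1 rfl, fun y hy => hf0 hy⟩

theorem exists_mul_eq_of_forall_ne_zero {u F : C_c(X, ℝ)}
    (hF : ∀ x ∈ tsupport u, F x ≠ 0) : ∃ v : C_c(X, ℝ), F * v = u := by
  have hv : Continuous fun x => u x * (F x)⁻¹ := by
    refine continuous_of_tsupport fun x hx => ?_
    have hx' : x ∈ tsupport u := closure_mono (fun y hy => left_ne_zero_of_mul hy) hx
    exact u.continuous.continuousAt.mul (F.continuous.continuousAt.inv₀ (hF x hx'))
  refine ⟨⟨⟨_, hv⟩, u.hasCompactSupport.mul_right⟩, ext fun x => ?_⟩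
  change F x * (u x * (F x)⁻¹) = u x
  by_cases hx : F x = 0
  · have : u x = 0 := by
      by_contra h
      exact hF x (subset_tsupport _ h) hx
    simp [this]
  · field_simp

/-- A linear functional on `C_c(X, ℝ)` whose kernel contains, for each point of a compact set `K`,
a function not vanishing at that point has in its kernel a function that is positive on `K`. -/
theorem exists_map_eq_zero_and_pos_on {φ : C_c(X, ℝ) →ₗ[ℝ] ℝ}
    (hφ : ∀ f g, φ (f * g) = φ f * φ g) {K : Set X} (hK : IsCompact K)
    (h : ∀ x ∈ K, ∃ f, φ f = 0 ∧ f x ≠ 0) :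
    ∃ F : C_c(X, ℝ), φ F = 0 ∧ (∀ x, 0 ≤ F x) ∧ ∀ x ∈ K, 0 < F x := by
  refine hK.induction_on (p := fun s => ∃ F : C_c(X, ℝ), φ F = 0 ∧ (∀ x, 0 ≤ F x) ∧
    ∀ x ∈ s, 0 < F x) ⟨0, by simp⟩ ?_ ?_ ?_
  · rintro s t hst ⟨F, h0, hF, ht⟩
    exact ⟨F, h0, hF, fun x hx => ht x (hst hx)⟩
  · rintro s t ⟨F, hF0, hF, hs⟩ ⟨G, hG0, hG, ht⟩
    refine ⟨F + G, by simp [hF0, hG0], fun x => add_nonneg (hF x) (hG x), ?_⟩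
    rintro x (hx | hx)
    · exact add_pos_of_pos_of_nonneg (hs x hx) (hG x)
    · exact add_pos_of_nonneg_of_pos (hF x) (ht x hx)
  · intro x hx
    obtain ⟨f, hf0, hfx⟩ := h x hx
    exact ⟨{y | f y ≠ 0},
      mem_nhdsWithin_of_mem_nhds ((isOpen_ne_fun f.continuous continuous_const).mem_nhds hfx),
      f * f, by simp [hφ, hf0], fun y => mul_self_nonneg (f y),
      fun y hy => mul_self_pos.2 hy⟩

/-- Every nonzero multiplicative linear functional on `C_c(X, ℝ)` is evaluation at a point. -/
theorem exists_forall_map_eq_apply [LocallyCompactSpace X] [T2Space X]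
    {φ : C_c(X, ℝ) →ₗ[ℝ] ℝ} (hφ : ∀ f g, φ (f * g) = φ f * φ g) (hne : ∃ u, φ u ≠ 0) :
    ∃ x, ∀ f, φ f = f x := by
  obtain ⟨u, hu⟩ := hne
  obtain ⟨x, hx⟩ : ∃ x, ∀ f, φ f = 0 → f x = 0 := by
    by_contra! h
    obtain ⟨F, hF0, -, hF⟩ := exists_map_eq_zero_and_pos_on hφ
      (K := tsupport u) u.hasCompactSupport fun x _ => h x
    obtain ⟨v, rfl⟩ := exists_mul_eq_of_forall_ne_zero fun x hx => (hF x hx).ne'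
    exact hu (by rw [hφ, hF0, zero_mul])
  have key : ∀ f, φ u * f x = φ f * u x := fun f => by
    have := hx (φ u • f - φ f • u) (by simp [mul_comm])
    simpa [sub_eq_zero] using this
  obtain ⟨f₀, hf₀, -⟩ := exists_apply_eq_one_of_mem_isOpen isOpen_univ (mem_univ x)
  have hux : u x ≠ 0 := fun h => hu (by simpa [h, hf₀] using key f₀)
  have h1 := key (u * u)
  rw [hφ, mul_apply] at h1
  have h2 : u x = φ u := mul_left_cancel₀ (mul_ne_zero hu hux) (by linear_combination h1)
  refine ⟨x, fun f => mul_right_cancel₀ hu ?_⟩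
  have := key f
  rw [h2] at this
  linear_combination -this

section Equiv

variable {Y : Type*} [TopologicalSpace Y]
  [LocallyCompactSpace X] [T2Space X] [LocallyCompactSpace Y] [T2Space Y]

theorem eq_of_forall_apply_eq {x y : X} (h : ∀ f : C_c(X, ℝ), f x = f y) : x = y := by
  by_contra hxy
  obtain ⟨f, hfx, hfy⟩ := exists_apply_eq_one_of_mem_isOpen
    (isOpen_compl_singleton (x := y)) (mem_compl_singleton_iff.2 hxy)
  have := h f
  rw [hfx, hfy y (by simp)] at this
  exact one_ne_zero this

theorem exists_continuous_comp_of_mul_linearEquiv (T : C_c(Y, ℝ) ≃ₗ[ℝ] C_c(X, ℝ))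
    (hT : ∀ f g, T (f * g) = T f * T g) :
    ∃ τ : X → Y, Continuous τ ∧ ∀ g x, T g x = g (τ x) := by
  have h (x : X) : ∃ y, ∀ g, T g x = g y := by
    let φ : C_c(Y, ℝ) →ₗ[ℝ] ℝ :=
      { toFun := fun g => T g x
        map_add' := fun f g => by simp
        map_smul' := fun c g => by simp }
    refine exists_forall_map_eq_apply (φ := φ) (fun f g => ?_) ?_
    · change T (f * g) x = T f x * T g x
      rw [hT, mul_apply]
    · obtain ⟨f, hf, -⟩ := exists_apply_eq_one_of_mem_isOpen isOpen_univ (mem_univ x)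
      refine ⟨T.symm f, ?_⟩
      change T (T.symm f) x ≠ 0
      simp [hf]
  choose τ hτ using h
  refine ⟨τ, continuous_iff_continuousAt.2 fun x => ?_, fun g x => hτ x g⟩
  intro V hV
  obtain ⟨U, hUV, hU, hxU⟩ := mem_nhds_iff.1 hV
  obtain ⟨g, hg1, hg0⟩ := exists_apply_eq_one_of_mem_isOpen hU hxU
  have hmem : {z | T g z ≠ 0} ∈ 𝓝 x :=
    (isOpen_ne_fun (T g).continuous continuous_const).mem_nhds (by simp [hτ, hg1])
  refine Filter.mem_map.2 (Filter.mem_of_superset hmem fun z hz => hUV ?_)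
  by_contra hzU
  exact hz (by rw [hτ, hg0 _ hzU])

/-- A multiplicative linear equivalence between the algebras of compactly supported continuous
functions on locally compact Hausdorff spaces is composition with a unique homeomorphism. -/
theorem existsUnique_homeomorph_of_mul_linearEquiv (T : C_c(Y, ℝ) ≃ₗ[ℝ] C_c(X, ℝ))
    (hT : ∀ f g, T (f * g) = T f * T g) :
    ∃! τ : X ≃ₜ Y, ∀ g, ⇑(T g) = ⇑g ∘ ⇑τ := by
  obtain ⟨τ, hτc, hτ⟩ := exists_continuous_comp_of_mul_linearEquiv T hT
  obtain ⟨σ, hσc, hσ⟩ := exists_continuous_comp_of_mul_linearEquiv T.symm fun f g =>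
    T.injective (by simp [hT])
  refine ⟨⟨⟨τ, σ, fun x => eq_of_forall_apply_eq fun f => ?_,
    fun y => eq_of_forall_apply_eq fun g => ?_⟩, hτc, hσc⟩, fun g => funext (hτ g), ?_⟩
  · rw [← hσ, ← hτ, T.apply_symm_apply]
  · rw [← hτ, ← hσ, T.symm_apply_apply]
  · intro τ' hτ'
    ext x
    refine eq_of_forall_apply_eq fun g => ?_
    exact (congrFun (hτ' g) x).symm.trans (hτ g x)

end Equiv

end CompactlySupportedContinuousMap

/-- **Continuous compactly supported version of Mrčun's theorem.** For Hausdorff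
topological manifolds `M` and `N` (locally Euclidean Hausdorff spaces, not assumed
second-countable, paracompact or connected), any isomorphism of the non-unital
ℝ-algebras of continuous compactly supported functions, i.e. any bijective ℝ-linear
multiplicative map `T : C_c(N, ℝ) → C_c(M, ℝ)`, is given by composition with a unique
homeomorphism `τ : M → N`. -/
theorem compactly_supported_continuous_function_algebra_iso_is_comp_homeomorph
    {dM dN : ℕ}
    {M : Type*} [TopologicalSpace M] [T2Space M]
    [ChartedSpace (EuclideanSpace ℝ (Fin dM)) M]
    {N : Type*} [TopologicalSpace N] [T2Space N]
    [ChartedSpace (EuclideanSpace ℝ (Fin dN)) N]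
    (T : C_c(N, ℝ) ≃ₗ[ℝ] C_c(M, ℝ))
    (hT : ∀ f g : C_c(N, ℝ), T (f * g) = T f * T g) :
    ∃! τ : M ≃ₜ N, ∀ g : C_c(N, ℝ), ⇑(T g) = ⇑g ∘ ⇑τ := by
  have := ChartedSpace.locallyCompactSpace (EuclideanSpace ℝ (Fin dM)) M
  have := ChartedSpace.locallyCompactSpace (EuclideanSpace ℝ (Fin dN)) N
  exact CompactlySupportedContinuousMap.existsUnique_homeomorph_of_mul_linearEquiv T hT
end
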